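/- arXiv:1207.0828 — 3 statements merged into one kernel-verified Lean document; each statement's English description precedes it below -/
import Mathlib

section
/- Let H be a complex Hilbert space and let T be an invertible bounded linear operator on H with T² = I. If T = U|T| is the polar decomposition of T (where U is the unitary factor), then U² = I; in particular, U is self-adjoint (U* = U). -/
/-- In a C⋆-algebra, the polar factor of an involution is self-adjoint, with square one. -/
theorem CStarAlgebra.polar_factor_of_mul_self_eq_one {A : Type*} [CStarAlgebra A] [PartialOrder A]
    [StarOrderedRing A] {t u p : A} (ht : t * t = 1) (hp : 0 ≤ p) (hpp : p * p = star t * t)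
    (hu : t = u * p) : u * u = 1 ∧ star u = u := by
  have hps : star p = p := (IsSelfAdjoint.of_nonneg hp).star_eq
  have hst : star t * star t = 1 := by rw [← star_mul, ht, star_one]
  obtain ⟨q, hq⟩ : ∃ q, q = t * star t * p := ⟨_, rfl⟩
  have hqp : q * p = 1 := by
    calc q * p = t * star t * (p * p) := by rw [hq, mul_assoc]
      _ = t * (star t * star t) * t := by rw [hpp]; simp only [mul_assoc]
      _ = 1 := by rw [hst, mul_one, ht]
  have hpq' : p * star q = 1 := by simpa [hps] using congrArg star hqp
  have hqs : star q = q := (left_inv_eq_right_inv hqp hpq').symm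
  have hpq : p * q = 1 := by rwa [hqs] at hpq'
  have hq0 : 0 ≤ q := by
    simpa [hqs, hqp] using star_left_conjugate_nonneg hp q
  have huq : u = t * q := by rw [hu, mul_assoc, hpq, mul_one]
  have huu : star u * u = 1 := by
    calc star u * u = q * (star t * t) * q := by rw [huq, star_mul, hqs]; simp only [mul_assoc]
      _ = (q * p) * (p * q) := by rw [← hpp]; simp only [mul_assoc]
      _ = 1 := by rw [hqp, hpq, mul_one]
  have hsq : (u * p * star u) * (u * p * star u) = q * q := by
    calc (u * p * star u) * (u * p * star u) = u * p * (star u * u) * (p * star u) := by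
          simp only [mul_assoc]
      _ = t * star t := by rw [huu, mul_one, ← hu, hu, star_mul, hps]
      _ = t * star t * p * q := by rw [mul_assoc _ p, hpq, mul_one]
      _ = q * q := by rw [← hq]
  have hconj : u * p * star u = q := by
    rw [← CFC.sqrt_mul_self (u * p * star u) (star_right_conjugate_nonneg hp u), hsq,
      CFC.sqrt_mul_self q hq0]
  have hupu : u * p * u = q := by
    calc u * p * u = t * t * q := by rw [← hu, huq, mul_assoc]
      _ = q := by rw [ht, one_mul]
  have hsu : star u = u := by
    have h : t * star u = t * u := by rw [hu, hconj, hupu]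
    simpa [← mul_assoc, ht] using congrArg (t * ·) h
  exact ⟨by rwa [hsu] at huu, hsu⟩

/-- Let `H` be a complex Hilbert space and `T` an invertible bounded
linear operator on `H` with `T² = I` (here `T * T = 1` makes `T` invertible, being its own
inverse).  If `absT` is the unique positive square root of `T*T` (i.e. `|T|`) and
`U` is the factor in the polar decomposition `T = U * |T|` (this determines `U`
uniquely since `|T|` is invertible, and `U` is unitary), then `U² = I`; in particular
`U` is self-adjoint. -/
theorem stmt_0 {H : Type*} [NormedAddCommGroup H] [InnerProductSpace ℂ H] [CompleteSpace H]
    (T U absT : H →L[ℂ] H)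
    (hT : T * T = 1)
    (habs_pos : absT.IsPositive)
    (habs_sq : absT * absT = ContinuousLinearMap.adjoint T * T)
    (hU : T = U * absT) :
    U * U = 1 ∧ ContinuousLinearMap.adjoint U = U := by
  exact CStarAlgebra.polar_factor_of_mul_self_eq_one hT
    ((ContinuousLinearMap.nonneg_iff_isPositive absT).mpr habs_pos) habs_sq hU
end

section
/- Let H be a complex Hilbert space and let T be an invertible bounded linear operator on H with T² = I. Then the unitary factor U = T|T|⁻¹ in the polar decomposition of T satisfies U = T*|T|. -/
/-- If `T` is an invertible bounded operator on a complex Hilbert space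
with `T² = I` (the hypothesis `T * T = 1` makes `T` invertible), `absT = |T|` is the
unique positive square root of `T*T`, and `absTinv = |T|⁻¹` is its inverse, then the
unitary factor `U = T |T|⁻¹` of the polar decomposition of `T` satisfies `U = T* |T|`. -/
theorem stmt_4 {H : Type*} [NormedAddCommGroup H] [InnerProductSpace ℂ H] [CompleteSpace H]
    (T absT absTinv : H →L[ℂ] H)
    (hT : T * T = 1)
    (habs_pos : absT.IsPositive)
    (habs_sq : absT * absT = ContinuousLinearMap.adjoint T * T)
    (hinv₁ : absT * absTinv = 1) (hinv₂ : absTinv * absT = 1) :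
    T * absTinv = ContinuousLinearMap.adjoint T * absT := by
  have hadj : ContinuousLinearMap.adjoint T * ContinuousLinearMap.adjoint T = 1 := by
    rw [← ContinuousLinearMap.star_eq_adjoint, ← star_mul, hT, star_one]
  symm
  calc ContinuousLinearMap.adjoint T * absT
      = ContinuousLinearMap.adjoint T * (absT * absT) * absTinv := by
        simp only [mul_assoc, hinv₁, mul_one]
    _ = T * absTinv := by
        rw [habs_sq, ← mul_assoc, hadj, one_mul]
end

section
/- Let H be a complex Hilbert space, let T be an invertible bounded linear operator on H with T² = I, and let J be a conjugation on H with JT = TJ. If U is the unitary factor in the polar decomposition T = U|T|, then JU = UJ. -/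
/-- A conjugate-linear isometry conjugates the inner product. -/
theorem LinearIsometry.inner_map_map_conj {E F : Type*} [NormedAddCommGroup E]
    [InnerProductSpace ℂ E] [NormedAddCommGroup F] [InnerProductSpace ℂ F]
    (J : E →ₗᵢ⋆[ℂ] F) (x y : E) : inner ℂ (J x) (J y) = inner ℂ y x := by
  have h₁ : J x - Complex.I • J y = J (x + Complex.I • y) := by
    simp [map_smulₛₗ, sub_eq_add_neg]
  have h₂ : J x + Complex.I • J y = J (x - Complex.I • y) := by
    simp [map_smulₛₗ]
  rw [← inner_conj_symm y x, inner_eq_sum_norm_sq_div_four, inner_eq_sum_norm_sq_div_four x y]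
  simp only [RCLike.I_to_complex, h₁, h₂, ← map_add, ← map_sub, J.norm_map]
  simp only [map_div₀, map_add, map_sub, map_mul, map_pow, Complex.coe_algebraMap,
    Complex.conj_ofReal, Complex.conj_I, map_ofNat]
  ring

section Conjugation

variable {H : Type*} [NormedAddCommGroup H] [InnerProductSpace ℂ H] (J : H →ₗᵢ⋆[ℂ] H)

/-- The linear operator `J A J`, for a conjugate-linear isometry `J`. -/
def LinearIsometry.conjOperator (A : H →L[ℂ] H) : H →L[ℂ] H :=
  J.toContinuousLinearMap.comp (A.comp J.toContinuousLinearMap)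

@[simp]
theorem LinearIsometry.conjOperator_apply (A : H →L[ℂ] H) (x : H) :
    J.conjOperator A x = J (A (J x)) := rfl

variable {J}

theorem LinearIsometry.inner_map_left_eq_of_involutive (hJ : Function.Involutive J) (x y : H) :
    inner ℂ (J x) y = inner ℂ (J y) x := by
  rw [← J.inner_map_map_conj, hJ x]

theorem LinearIsometry.inner_map_right_eq_of_involutive (hJ : Function.Involutive J) (x y : H) :
    inner ℂ x (J y) = inner ℂ y (J x) := by
  rw [← J.inner_map_map_conj, hJ y]

theorem LinearIsometry.conjOperator_mul (hJ : Function.Involutive J) (A B : H →L[ℂ] H) :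
    J.conjOperator (A * B) = J.conjOperator A * J.conjOperator B := by
  ext x
  simp [hJ _]

theorem LinearIsometry.conjOperator_eq_self_iff (hJ : Function.Involutive J) {A : H →L[ℂ] H} :
    J.conjOperator A = A ↔ ∀ x, J (A x) = A (J x) := by
  refine ⟨fun h x => ?_, fun h => ?_⟩
  · rw [← DFunLike.congr_fun h (J x), conjOperator_apply, hJ x]
  · ext x
    rw [conjOperator_apply, h, hJ x]

theorem LinearIsometry.isPositive_conjOperator (hJ : Function.Involutive J) {A : H →L[ℂ] H}
    (hA : A.IsPositive) : (J.conjOperator A).IsPositive := by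
  rw [ContinuousLinearMap.isPositive_iff_complex]
  intro x
  rw [conjOperator_apply, inner_map_left_eq_of_involutive hJ, ← hA.inner_left_eq_inner_right]
  exact (ContinuousLinearMap.isPositive_iff_complex A).1 hA (J x)

variable [CompleteSpace H]

theorem LinearIsometry.adjoint_conjOperator (hJ : Function.Involutive J) (A : H →L[ℂ] H) :
    ContinuousLinearMap.adjoint (J.conjOperator A) =
      J.conjOperator (ContinuousLinearMap.adjoint A) := by
  symm
  rw [ContinuousLinearMap.eq_adjoint_iff]
  intro x y
  rw [conjOperator_apply, conjOperator_apply, inner_map_left_eq_of_involutive hJ,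
    inner_map_right_eq_of_involutive hJ, ContinuousLinearMap.adjoint_inner_right]

end Conjugation

/-- Positive square roots of bounded operators are unique. -/
theorem ContinuousLinearMap.IsPositive.eq_of_mul_self_eq {H : Type*} [NormedAddCommGroup H]
    [InnerProductSpace ℂ H] [CompleteSpace H] {A B : H →L[ℂ] H} (hA : A.IsPositive)
    (hB : B.IsPositive) (h : A * A = B * B) : A = B := by
  rw [← ContinuousLinearMap.nonneg_iff_isPositive] at hA hB
  exact (CFC.sqrt_unique h hA).symm.trans (CFC.sqrt_unique rfl hB)

/-- Let `T` be an invertible bounded operator on a complex Hilbert space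
with `T² = I` (the hypothesis `T * T = 1` makes `T` invertible), and let `J` be a
conjugation (an additive, conjugate-linear, isometric involution) with `J T = T J`.
If `absT = |T|` is the unique positive square root of `T*T` and `U` is the unitary factor
of the polar decomposition `T = U |T|` (determined by `T = U * absT` since `|T|` is
invertible here), then `J U = U J`. -/
theorem stmt_7 {H : Type*} [NormedAddCommGroup H] [InnerProductSpace ℂ H] [CompleteSpace H]
    (J : H → H) (T U absT : H →L[ℂ] H)
    (hT : T * T = 1)
    (hJ_add : ∀ x y, J (x + y) = J x + J y)
    (hJ_smul : ∀ (c : ℂ) (x : H), J (c • x) = (starRingEnd ℂ c) • J x)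
    (hJ_iso : ∀ x, ‖J x‖ = ‖x‖)
    (hJ_inv : ∀ x, J (J x) = x)
    (hcomm : ∀ x, J (T x) = T (J x))
    (habs_pos : absT.IsPositive)
    (habs_sq : absT * absT = ContinuousLinearMap.adjoint T * T)
    (hU : T = U * absT) :
    ∀ x, J (U x) = U (J x) := by
  let K : H →ₗᵢ⋆[ℂ] H := ⟨⟨⟨J, hJ_add⟩, hJ_smul⟩, hJ_iso⟩
  have hK : Function.Involutive K := hJ_inv
  have hKT : K.conjOperator T = T := (LinearIsometry.conjOperator_eq_self_iff hK).2 hcomm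
  have hKabs : K.conjOperator absT = absT := by
    refine (LinearIsometry.isPositive_conjOperator hK habs_pos).eq_of_mul_self_eq habs_pos ?_
    rw [← LinearIsometry.conjOperator_mul hK, habs_sq, LinearIsometry.conjOperator_mul hK,
      ← LinearIsometry.adjoint_conjOperator hK, hKT]
  have habs_comm : ∀ x, J (absT x) = absT (J x) :=
    (LinearIsometry.conjOperator_eq_self_iff hK).1 hKabs
  have hT_adj : ContinuousLinearMap.adjoint T * ContinuousLinearMap.adjoint T = 1 := by
    rw [← ContinuousLinearMap.star_eq_adjoint, ← star_mul, hT, star_one]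
  have habs_inv : absT * (absT * (T * ContinuousLinearMap.adjoint T)) = 1 := by
    rw [← mul_assoc, habs_sq, mul_assoc, ← mul_assoc T, hT, one_mul, hT_adj]
  intro x
  obtain ⟨y, rfl⟩ : ∃ y, absT y = x := ⟨_, DFunLike.congr_fun habs_inv x⟩
  have hU_apply (z : H) : U (absT z) = T z := by rw [hU]; rfl
  rw [hU_apply, hcomm, habs_comm, hU_apply]
end
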